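/- arXiv:math/0404079 — 2 statements merged into one kernel-verified Lean document; each statement's English description precedes it below -/
import Mathlib

section
/- For every integer n ≥ 4, the number of partitions λ = (λ_1 ≥ ... ≥ λ_n ≥ 0) with n parts and |λ| = d for which there exists an index i with λ_i = λ_{i+1} + 1, and λ_j − λ_{j+1} ≥ 2 for all j with j ≤ i−2 or i+1 ≤ j ≤ n−1, satisfies the generating function identity Σ_{d=0}^∞ #{such λ} q^d = (q^{(n-2)²+1}/(q)_n) · Σ_{i=0}^{n-2} q^{3i}(1−q^{n-1-i}), as formal power series in q, where (q)_n = ∏_{j=1}^n (1 − q^j) and division means multiplication by the inverse of this unit in the formal power series ring. -/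
open Finset

/-- A partition with `n` (possibly zero) parts, encoded as a weakly decreasing function
`ℕ → ℕ` (0-indexed: `l 0, …, l (n-1)` are the parts `λ_1, …, λ_n`) vanishing from index `n` on. -/
def PartitionN (n : ℕ) (l : ℕ → ℕ) : Prop :=
  Antitone l ∧ ∀ j, n ≤ j → l j = 0

/-- `(q)_s = ∏_{j=1}^s (1 - q^j)` as a formal power series over `ℚ`. -/
noncomputable def qPoch (s : ℕ) : PowerSeries ℚ :=
  ∏ j ∈ Finset.range s, (1 - (PowerSeries.X : PowerSeries ℚ) ^ (j + 1))

/-- Case-4 condition (0-based index `i`): `λ_i = λ_{i+1} + 1`, and `λ_j - λ_{j+1} ≥ 2`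
for `j ≤ i-2` or `j ≥ i+1` (0-based). -/
def Case4 (n : ℕ) (l : ℕ → ℕ) : Prop :=
  ∃ i : ℕ, i + 2 ≤ n ∧ l i = l (i + 1) + 1 ∧
    (∀ j, j + 1 < n → (j + 2 ≤ i ∨ i + 1 ≤ j) → l (j + 1) + 2 ≤ l j)

lemma sum_range_eq_sum_mul_sub {l : ℕ → ℕ} (hl : Antitone l) (m : ℕ) :
    ∑ j ∈ range m, l j = ∑ j ∈ range m, (j + 1) * (l j - l (j + 1)) + m * l m := by
  induction m with
  | zero => simp
  | succ m ih =>
    rw [sum_range_succ, sum_range_succ, ih]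
    obtain ⟨c, hc⟩ := Nat.exists_eq_add_of_le (hl (Nat.le_succ m))
    simp only [Nat.succ_eq_add_one] at hc
    rw [hc, Nat.add_sub_cancel_left]
    ring

/-- The weighted differences `(j + 1) * (l j - l (j + 1))`, for `j < n`, of a sequence `l`. -/
noncomputable def weightedDiff (n : ℕ) (l : ℕ → ℕ) : ℕ →₀ ℕ :=
  Finsupp.indicator (range n) fun j _ => (j + 1) * (l j - l (j + 1))

lemma weightedDiff_apply {n j : ℕ} (l : ℕ → ℕ) (hj : j < n) :
    weightedDiff n l j = (j + 1) * (l j - l (j + 1)) := by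
  simp [weightedDiff, hj]

lemma weightedDiff_mem_finsuppAntidiag {n : ℕ} {l : ℕ → ℕ} (hl : PartitionN n l) :
    weightedDiff n l ∈ finsuppAntidiag (range n) (∑ j ∈ range n, l j) := by
  rw [mem_finsuppAntidiag]
  refine ⟨?_, Finsupp.support_indicator_subset ..⟩
  rw [sum_range_eq_sum_mul_sub hl.1 n, hl.2 n le_rfl, mul_zero, add_zero]
  exact sum_congr rfl fun j hj => weightedDiff_apply l (mem_range.1 hj)

lemma weightedDiff_injOn (n : ℕ) : Set.InjOn (weightedDiff n) {l | PartitionN n l} := by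
  intro l hl m hm h
  have key : ∀ k, ∀ j, n ≤ j + k → l j = m j := by
    intro k
    induction k with
    | zero => intro j hj; rw [hl.2 j hj, hm.2 j hj]
    | succ k ih =>
      intro j hj
      rcases le_or_gt n j with hnj | hnj
      · rw [hl.2 j hnj, hm.2 j hnj]
      · have h1 := ih (j + 1) (by omega)
        have h2 := DFunLike.congr_fun h j
        rw [weightedDiff_apply l hnj, weightedDiff_apply m hnj] at h2
        have h3 := Nat.eq_of_mul_eq_mul_left (Nat.succ_pos j) h2
        have h4 := hl.1 (Nat.le_succ j)
        have h5 := hm.1 (Nat.le_succ j)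
        simp only [Nat.succ_eq_add_one] at h4 h5
        omega
  funext j
  exact key n j (Nat.le_add_left ..)

lemma exists_partitionN_sub_eq (n : ℕ) (c : ℕ → ℕ) :
    ∃ l, PartitionN n l ∧ ∀ j < n, l j - l (j + 1) = c j := by
  have hsucc : ∀ j < n, ∑ k ∈ Ico j n, c k = c j + ∑ k ∈ Ico (j + 1) n, c k :=
    fun j hj => sum_eq_sum_Ico_succ_bot hj c
  refine ⟨fun j => ∑ k ∈ Ico j n, c k, ⟨?_, ?_⟩, ?_⟩
  · exact fun i j hij => sum_le_sum_of_subset (Ico_subset_Ico_left hij)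
  · intro j hj
    simp [Ico_eq_empty_of_le hj]
  · intro j hj
    simp only [hsucc j hj, Nat.add_sub_cancel]

/-- The partitions of `d` with `n` parts and with `j`-th difference in `D j` for all `j < n`. -/
def partitionsWithDiffs (n d : ℕ) (D : ℕ → Set ℕ) : Set (ℕ → ℕ) :=
  {l | PartitionN n l ∧ ∑ j ∈ range n, l j = d ∧ ∀ j < n, l j - l (j + 1) ∈ D j}

lemma partitionsWithDiffs_finite (n d : ℕ) (D : ℕ → Set ℕ) :
    (partitionsWithDiffs n d D).Finite := by
  refine Set.Finite.of_injOn (t := finsuppAntidiag (range n) d) (f := weightedDiff n) ?_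
    ((weightedDiff_injOn n).mono fun l hl => hl.1) (finite_toSet _)
  rintro l ⟨hl, rfl, -⟩
  exact weightedDiff_mem_finsuppAntidiag hl

open Classical in
/-- The generating function of the multiples `w * c` with `c ∈ D`. -/
noncomputable def multiplesSeries (w : ℕ) (D : Set ℕ) : PowerSeries ℚ :=
  PowerSeries.mk fun k => if ∃ c ∈ D, w * c = k then 1 else 0

lemma ncard_partitionsWithDiffs (n d : ℕ) (D : ℕ → Set ℕ) :
    ((partitionsWithDiffs n d D).ncard : ℚ) =
      PowerSeries.coeff d (∏ j ∈ range n, multiplesSeries (j + 1) (D j)) := by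
  classical
  rw [PowerSeries.coeff_prod]
  simp only [multiplesSeries, PowerSeries.coeff_mk, prod_boole, sum_boole]
  rw [← Set.ncard_coe_finset]
  congr 1
  refine Set.ncard_congr (fun l _ => weightedDiff n l) ?_ ?_ ?_
  · rintro l ⟨hl, rfl, hD⟩
    simp only [coe_filter, Set.mem_ofPred_eq]
    refine ⟨weightedDiff_mem_finsuppAntidiag hl, fun j hj => ?_⟩
    exact ⟨_, hD j (mem_range.1 hj), (weightedDiff_apply l (mem_range.1 hj)).symm⟩
  · exact fun l m hl hm h => weightedDiff_injOn n hl.1 hm.1 h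
  · intro g hg
    simp only [coe_filter, Set.mem_ofPred_eq] at hg
    obtain ⟨hg, hD⟩ := hg
    choose! c hcD hc using hD
    obtain ⟨l, hl, hlc⟩ := exists_partitionN_sub_eq n c
    have hgl : weightedDiff n l = g := by
      ext j
      by_cases hj : j < n
      · rw [weightedDiff_apply l hj, hlc j hj, hc j (mem_range.2 hj)]
      · rw [weightedDiff, Finsupp.indicator_of_notMem (by simpa using hj)]
        exact (Finsupp.notMem_support_iff.1 fun h =>
          hj (mem_range.1 ((mem_finsuppAntidiag.1 hg).2 h))).symm
    refine ⟨l, ⟨hl, ?_, fun j hj => hlc j hj ▸ hcD j (mem_range.2 hj)⟩, hgl⟩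
    have h := weightedDiff_mem_finsuppAntidiag hl
    rw [hgl] at h
    rw [← (mem_finsuppAntidiag.1 h).1, (mem_finsuppAntidiag.1 hg).1]

lemma multiplesSeries_singleton (w c : ℕ) :
    multiplesSeries w {c} = PowerSeries.X ^ (w * c) := by
  ext k
  simp [multiplesSeries, PowerSeries.coeff_X_pow, eq_comm]

lemma multiplesSeries_Ici_mul {w : ℕ} (hw : 0 < w) (a : ℕ) :
    multiplesSeries w (Set.Ici a) * (1 - PowerSeries.X ^ w) = PowerSeries.X ^ (w * a) := by
  ext k
  rw [mul_sub, mul_one, map_sub, PowerSeries.coeff_mul_X_pow', PowerSeries.coeff_X_pow]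
  simp only [multiplesSeries, PowerSeries.coeff_mk]
  have hiff : (∃ c ∈ Set.Ici a, w * c = k) ↔
      k = w * a ∨ (w ≤ k ∧ ∃ c ∈ Set.Ici a, w * c = k - w) := by
    constructor
    · rintro ⟨c, hc, rfl⟩
      rcases (Set.mem_Ici.1 hc).eq_or_lt with rfl | hc
      · exact .inl rfl
      · obtain ⟨b, rfl⟩ := Nat.exists_eq_add_of_lt hc
        refine .inr ⟨Nat.le_mul_of_pos_right _ (by omega), a + b, Set.mem_Ici.2 (by omega), ?_⟩
        rw [mul_add w (a + b) 1, mul_one, Nat.add_sub_cancel]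
    · rintro (rfl | ⟨hk, c, hc, h⟩)
      · exact ⟨a, Set.mem_Ici.2 le_rfl, rfl⟩
      · have hc := Set.mem_Ici.1 hc
        exact ⟨c + 1, Set.mem_Ici.2 (by omega), by rw [mul_add, mul_one]; omega⟩
  have hdisj : ¬ (k = w * a ∧ w ≤ k ∧ ∃ c ∈ Set.Ici a, w * c = k - w) := by
    rintro ⟨rfl, hk, c, hc, h⟩
    have := Nat.mul_le_mul_left w (Set.mem_Ici.1 hc)
    omega
  classical
  rw [← ite_and, if_congr hiff rfl rfl]
  by_cases h1 : k = w * a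
  · rw [if_pos (.inl h1), if_pos h1, if_neg fun h => hdisj ⟨h1, h⟩, sub_zero]
  · by_cases h2 : w ≤ k ∧ ∃ c ∈ Set.Ici a, w * c = k - w
    · rw [if_pos (.inr h2), if_pos h2, if_neg h1, sub_self]
    · rw [if_neg (not_or.2 ⟨h1, h2⟩), if_neg h2, if_neg h1, sub_self]

/-- The differences allowed by `Case4` with witness `i`; the last one is the smallest part. -/
def case4Diffs (n i j : ℕ) : Set ℕ :=
  if j = i then {1} else Set.Ici (if j + 1 = i ∨ j + 1 = n then 0 else 2)

lemma mem_case4Diffs_iff {n i : ℕ} {l : ℕ → ℕ} (hi : i + 2 ≤ n) :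
    (∀ j < n, l j - l (j + 1) ∈ case4Diffs n i j) ↔
      l i = l (i + 1) + 1 ∧
        ∀ j, j + 1 < n → (j + 2 ≤ i ∨ i + 1 ≤ j) → l (j + 1) + 2 ≤ l j := by
  constructor
  · intro h
    constructor
    · have := h i (by omega)
      simp only [case4Diffs, if_true, Set.mem_singleton_iff] at this
      omega
    · intro j hj hij
      have := h j (by omega)
      rw [case4Diffs, if_neg (by omega), if_neg (by omega), Set.mem_Ici] at this
      omega
  · rintro ⟨h1, h2⟩ j hj
    unfold case4Diffs
    split_ifs with hji h
    · subst hji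
      simp [h1]
    · simp
    · have := h2 j (by omega) (by omega)
      rw [Set.mem_Ici]
      omega

lemma sum_range_case4_exponent {n i : ℕ} (hi : i + 2 ≤ n) :
    ∑ j ∈ range n, (j + 1) * (if j = i then 1 else if j + 1 = i ∨ j + 1 = n then 0 else 2)
      + (3 * i + 1) = n * (n - 1) := by
  have htotal : ∀ m, ∑ j ∈ range m, 2 * (j + 1) = m * (m + 1) := by
    intro m
    induction m with
    | zero => simp
    | succ m ih => rw [sum_range_succ, ih]; ring
  have hpred : ∀ a ≤ n, ∑ j ∈ range n, (if j + 1 = a then 2 * (j + 1) else 0) = 2 * a := by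
    intro a ha
    cases a with
    | zero => simp
    | succ a => simp [Nat.lt_of_succ_le ha]
  have hsplit : ∀ j ∈ range n, 2 * (j + 1) =
      (j + 1) * (if j = i then 1 else if j + 1 = i ∨ j + 1 = n then 0 else 2)
        + ((if j = i then i + 1 else 0) + (if j + 1 = i then 2 * (j + 1) else 0)
          + (if j + 1 = n then 2 * (j + 1) else 0)) := by
    intro j _
    split_ifs <;> omega
  have h := sum_congr rfl hsplit
  rw [htotal, sum_add_distrib, sum_add_distrib, sum_add_distrib, hpred i (by omega),
    hpred n le_rfl, sum_ite_eq' (range n) i, if_pos (mem_range.2 (by omega))] at h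
  obtain ⟨m, rfl⟩ : ∃ m, n = m + 1 := ⟨n - 1, by omega⟩
  rw [Nat.add_sub_cancel]
  nlinarith

lemma prod_case4_series_mul_qPoch {n i : ℕ} (hi : i + 2 ≤ n) :
    (∏ j ∈ range n, multiplesSeries (j + 1) (case4Diffs n i j)) * qPoch n =
      PowerSeries.X ^ (n * (n - 1) - (3 * i + 1)) * (1 - PowerSeries.X ^ (i + 1)) := by
  have hfactor : ∀ j ∈ range n,
      multiplesSeries (j + 1) (case4Diffs n i j) * (1 - PowerSeries.X ^ (j + 1)) =
        PowerSeries.X ^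
            ((j + 1) * (if j = i then 1 else if j + 1 = i ∨ j + 1 = n then 0 else 2))
          * (if j = i then 1 - PowerSeries.X ^ (j + 1) else 1) := by
    intro j _
    unfold case4Diffs
    by_cases hj : j = i
    · simp only [if_pos hj, multiplesSeries_singleton]
    · simp only [if_neg hj, mul_one]
      exact multiplesSeries_Ici_mul (Nat.succ_pos j) _
  rw [qPoch, ← prod_mul_distrib, prod_congr rfl hfactor, prod_mul_distrib, prod_pow_eq_pow_sum,
    prod_ite_eq' (range n) i, if_pos (mem_range.2 (by omega)),
    Nat.eq_sub_of_add_eq (sum_range_case4_exponent hi)]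

lemma constantCoeff_qPoch (n : ℕ) : PowerSeries.constantCoeff (qPoch n) = 1 := by
  simp [qPoch, map_prod]

lemma setOf_case4_eq_biUnion (n d : ℕ) :
    {l : ℕ → ℕ | PartitionN n l ∧ ∑ j ∈ range n, l j = d ∧ Case4 n l} =
      ⋃ i ∈ range (n - 1), partitionsWithDiffs n d (case4Diffs n i) := by
  ext l
  simp only [Set.mem_ofPred_eq, Set.mem_iUnion, partitionsWithDiffs, mem_range, exists_prop]
  constructor
  · rintro ⟨hl, hd, i, hi, h⟩
    exact ⟨i, by omega, hl, hd, (mem_case4Diffs_iff hi).2 h⟩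
  · rintro ⟨i, hi, hl, hd, h⟩
    have hi : i + 2 ≤ n := by omega
    exact ⟨hl, hd, i, hi, (mem_case4Diffs_iff hi).1 h⟩

lemma disjoint_partitionsWithDiffs_case4Diffs {n i k : ℕ} (d : ℕ) (hik : i < k)
    (hk : k + 2 ≤ n) :
    Disjoint (partitionsWithDiffs n d (case4Diffs n i))
      (partitionsWithDiffs n d (case4Diffs n k)) := by
  rw [Set.disjoint_left]
  rintro l ⟨-, -, h⟩ ⟨-, -, h'⟩
  have h1 := ((mem_case4Diffs_iff (by omega)).1 h).2 k (by omega) (by omega)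
  have h2 := ((mem_case4Diffs_iff hk).1 h').1
  omega

lemma ncard_case4 (n d : ℕ) :
    Set.ncard {l : ℕ → ℕ | PartitionN n l ∧ ∑ j ∈ range n, l j = d ∧ Case4 n l} =
      ∑ i ∈ range (n - 1), (partitionsWithDiffs n d (case4Diffs n i)).ncard := by
  classical
  rw [setOf_case4_eq_biUnion]
  have hfin := fun i => partitionsWithDiffs_finite n d (case4Diffs n i)
  have hcoe : (⋃ i ∈ range (n - 1), partitionsWithDiffs n d (case4Diffs n i)) =
      (((range (n - 1)).biUnion fun i => (hfin i).toFinset : Finset (ℕ → ℕ)) : Set (ℕ → ℕ)) := by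
    simp
  rw [hcoe, Set.ncard_coe_finset, card_biUnion]
  · exact sum_congr rfl fun i _ => (Set.ncard_eq_toFinset_card _ (hfin i)).symm
  · intro i hi k hk hik
    rw [mem_coe, mem_range] at hi hk
    refine Set.Finite.disjoint_toFinset.2 ?_
    rcases hik.lt_or_gt with h | h
    · exact disjoint_partitionsWithDiffs_case4Diffs d h (by omega)
    · exact (disjoint_partitionsWithDiffs_case4Diffs d h (by omega)).symm

theorem case4_generating_function (n : ℕ) (hn : 4 ≤ n) :
    PowerSeries.mk (fun d => (Set.ncard {l : ℕ → ℕ | PartitionN n l ∧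
        (∑ j ∈ Finset.range n, l j) = d ∧ Case4 n l} : ℚ)) =
      PowerSeries.X ^ ((n - 2) ^ 2 + 1) * (qPoch n)⁻¹ *
        ∑ i ∈ Finset.range (n - 1), PowerSeries.X ^ (3 * i) *
          (1 - PowerSeries.X ^ (n - 1 - i)) := by
  have hmk : PowerSeries.mk (fun d => (Set.ncard {l : ℕ → ℕ | PartitionN n l ∧
        (∑ j ∈ Finset.range n, l j) = d ∧ Case4 n l} : ℚ)) =
      ∑ i ∈ range (n - 1), ∏ j ∈ range n, multiplesSeries (j + 1) (case4Diffs n i j) := by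
    ext d
    rw [PowerSeries.coeff_mk, ncard_case4, Nat.cast_sum, map_sum]
    exact sum_congr rfl fun i _ => ncard_partitionsWithDiffs n d _
  have hq : PowerSeries.constantCoeff (qPoch n) ≠ 0 := by simp [constantCoeff_qPoch]
  rw [hmk, mul_right_comm, PowerSeries.eq_mul_inv_iff_mul_eq hq, sum_mul, mul_sum,
    ← sum_range_reflect]
  refine sum_congr rfl fun k hk => ?_
  rw [mem_range] at hk
  rw [prod_case4_series_mul_qPoch (by omega), ← mul_assoc, ← pow_add]
  obtain ⟨i, rfl⟩ : ∃ i, n = i + k + 2 := ⟨n - 2 - k, by omega⟩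
  have h1 : i + k + 2 - 1 - 1 - k = i := by omega
  have h2 : i + k + 2 - 1 - k = i + 1 := by omega
  have h3 : (i + k + 2) * (i + k + 2 - 1) - (3 * i + 1) = (i + k + 2 - 2) ^ 2 + 1 + 3 * k := by
    rw [Nat.add_sub_cancel, show i + k + 2 - 1 = i + k + 1 from rfl]
    refine Nat.sub_eq_of_eq_add ?_
    ring
  rw [h1, h2, h3]
end

section
/- Let n ≥ 4 and let f ∈ ℂ[x_1,...,x_n] be a symmetric polynomial such that both substitutions x_2 := x_1, x_4 := x_3 and x_2 := x_1, x_3 := x_1 yield zero (i.e. f(x,x,y,y,x_5,...,x_n) = 0 and f(x,x,x,x_4,...,x_n) = 0 identically). Then there exists a polynomial h ∈ ℂ[z, x_3,...,x_n], symmetric under all permutations of x_3,...,x_n, such that f(z,z,x_3,...,x_n) = ∏_{i=3}^{n} (z − x_i)² · ∏_{3≤i<j≤n} (x_i − x_j)² · h(z, x_3,...,x_n). -/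
namespace MvPolynomial

section Identify

variable {τ R : Type*} [CommRing R] [DecidableEq τ]

/-- The substitution `X j := X i`. -/
noncomputable def identify (i j : τ) : MvPolynomial τ R →ₐ[R] MvPolynomial τ R :=
  aeval (Function.update X j (X i))

theorem identify_X (i j k : τ) :
    identify i j (X k : MvPolynomial τ R) = X (if k = j then i else k) := by
  simp only [identify, aeval_X, Function.update_apply]
  split_ifs <;> rfl

theorem identify_X_sub_X (i j : τ) : identify i j (X i - X j : MvPolynomial τ R) = 0 := by
  simp [identify_X]

theorem X_sub_X_dvd_sub_identify (i j : τ) (p : MvPolynomial τ R) :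
    X i - X j ∣ p - identify i j p := by
  rw [← Ideal.mem_span_singleton, ← Ideal.Quotient.eq]
  have key : Ideal.Quotient.mkₐ R (Ideal.span {(X i - X j : MvPolynomial τ R)}) =
      (Ideal.Quotient.mkₐ R (Ideal.span {(X i - X j : MvPolynomial τ R)})).comp
        (identify i j) := by
    ext k
    simp only [AlgHom.comp_apply, identify_X, Ideal.Quotient.mkₐ_eq_mk]
    split_ifs with h
    · subst h
      rw [eq_comm, Ideal.Quotient.eq]
      exact Ideal.mem_span_singleton_self _
    · rfl
  exact DFunLike.congr_fun key p

theorem X_sub_X_dvd_iff (i j : τ) (p : MvPolynomial τ R) :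
    X i - X j ∣ p ↔ identify i j p = 0 := by
  refine ⟨?_, fun h => by simpa [h] using X_sub_X_dvd_sub_identify i j p⟩
  rintro ⟨q, rfl⟩
  rw [map_mul, identify_X_sub_X, zero_mul]

theorem prime_X_sub_X [IsDomain R] {i j : τ} (hij : i ≠ j) :
    Prime (X i - X j : MvPolynomial τ R) := by
  refine ⟨sub_ne_zero.2 fun h => hij (X_injective h), fun h => ?_, fun a b hab => ?_⟩
  · simpa [identify_X_sub_X] using h.map (identify i j)
  · simpa only [X_sub_X_dvd_iff, map_mul, mul_eq_zero] using hab

theorem isRelPrime_X_sub_X [IsDomain R] {i j k l : τ} (hij : i ≠ j) (hkl : k ≠ l)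
    (h : ¬ (i = k ∧ j = l)) (h' : ¬ (i = l ∧ j = k)) :
    IsRelPrime (X i - X j : MvPolynomial τ R) (X k - X l) := by
  rw [(prime_X_sub_X hij).irreducible.isRelPrime_iff_not_dvd, X_sub_X_dvd_iff, map_sub,
    identify_X, identify_X, sub_eq_zero, X_inj]
  grind

theorem sq_X_sub_X_dvd_of_pderiv [IsDomain R] {i j : τ} (hij : i ≠ j) {p : MvPolynomial τ R}
    (hp : identify i j p = 0) (hp' : identify i j (pderiv j p) = 0) :
    (X i - X j) ^ 2 ∣ p := by
  obtain ⟨q, rfl⟩ := (X_sub_X_dvd_iff i j p).2 hp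
  rw [sq]
  refine mul_dvd_mul_left _ ((X_sub_X_dvd_iff i j q).2 ?_)
  simpa [Derivation.leibniz, pderiv_X_of_ne hij, identify_X] using hp'

theorem sq_X_sub_X_dvd_of_rename_swap [IsDomain R] [CharZero R] {i j : τ} (hij : i ≠ j)
    {p : MvPolynomial τ R} (hp : identify i j p = 0) (hp' : rename (Equiv.swap i j) p = p) :
    (X i - X j) ^ 2 ∣ p := by
  obtain ⟨q, rfl⟩ := (X_sub_X_dvd_iff i j p).2 hp
  rw [sq]
  refine mul_dvd_mul_left _ ((X_sub_X_dvd_iff i j q).2 ?_)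
  have hne : (X i - X j : MvPolynomial τ R) ≠ 0 := (prime_X_sub_X hij).ne_zero
  have hq : rename (Equiv.swap i j) q = -q := by
    refine mul_left_cancel₀ hne ?_
    simp only [map_mul, map_sub, rename_X, Equiv.swap_apply_left, Equiv.swap_apply_right] at hp'
    linear_combination -hp'
  have hcomp : (identify i j).comp (rename (Equiv.swap i j)) =
      (identify i j : MvPolynomial τ R →ₐ[R] MvPolynomial τ R) := by
    ext k
    simp only [AlgHom.comp_apply, rename_X, identify_X, Equiv.swap_apply_def]
    grind
  have := DFunLike.congr_fun hcomp q
  rw [AlgHom.comp_apply, hq, map_neg] at this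
  exact self_eq_neg.1 this.symm

theorem identify_identify (i j : τ) (p : MvPolynomial τ R) :
    identify i j (identify i j p) = identify i j p := by
  have h : (identify i j).comp (identify i j) =
      (identify i j : MvPolynomial τ R →ₐ[R] MvPolynomial τ R) := by
    ext1 k
    rw [AlgHom.comp_apply, identify_X, identify_X]
    grind
  exact DFunLike.congr_fun h p

theorem rename_identify (σ : Equiv.Perm τ) (i j : τ) (p : MvPolynomial τ R) :
    rename σ (identify i j p) = identify (σ i) (σ j) (rename σ p) := by
  have h : (rename σ).comp (identify i j) =
      (identify (σ i) (σ j) : MvPolynomial τ R →ₐ[R] MvPolynomial τ R).comp (rename σ) := by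
    ext1 k
    simp only [AlgHom.comp_apply, identify_X, rename_X, σ.injective.eq_iff]
    split_ifs <;> rfl
  exact DFunLike.congr_fun h p

end Identify

theorem pderiv_aeval {σ τ R : Type*} [CommRing R] [Fintype σ] (v : σ → MvPolynomial τ R) (k : τ)
    (p : MvPolynomial σ R) :
    pderiv k (aeval v p) = ∑ i, aeval v (pderiv i p) * pderiv k (v i) := by
  classical
  induction p using MvPolynomial.induction_on with
  | C a => simp [MvPolynomial.algebraMap_eq]
  | add p q hp hq => simp only [map_add, hp, hq, add_mul, Finset.sum_add_distrib]
  | mul_X p i hp =>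
    simp only [map_mul, aeval_X, Derivation.leibniz, hp, smul_eq_mul, map_add, add_mul,
      Finset.sum_add_distrib, pderiv_X, Pi.single_apply, Finset.mul_sum]
    simp [mul_assoc, mul_comm]

theorem pderiv_identify {τ R : Type*} [CommRing R] [DecidableEq τ] [Fintype τ] {i j k : τ}
    (hi : i ≠ k) (hj : j ≠ k) (p : MvPolynomial τ R) :
    pderiv k (identify i j p) = identify i j (pderiv k p) := by
  rw [identify, pderiv_aeval, Finset.sum_eq_single k, Function.update_of_ne hj.symm,
    pderiv_X_self, mul_one]
  · intro l _ hl
    rw [Function.update_apply]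
    split_ifs
    · rw [pderiv_X_of_ne hi, mul_zero]
    · rw [pderiv_X_of_ne hl, mul_zero]
  · simp

theorem IsSymmetric.rename_pderiv {σ R : Type*} [CommRing R] {f : MvPolynomial σ R}
    (hf : f.IsSymmetric) (e : Equiv.Perm σ) (i : σ) :
    rename e (pderiv i f) = pderiv (e i) f := by
  rw [← pderiv_rename e.injective, hf e]

end MvPolynomial

open MvPolynomial Finset

namespace DoubleDiag

variable {R : Type*} [CommRing R] {n : ℕ}

/-- The product of `(X i - X j) ^ 2` over all pairs `2 ≤ i < j`. -/
noncomputable def tailDiscr (R : Type*) [CommRing R] (n : ℕ) : MvPolynomial (Fin n) R :=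
  ∏ p ∈ univ.filter (fun p : Fin n × Fin n => 2 ≤ (p.1 : ℕ) ∧ p.1 < p.2), (X p.1 - X p.2) ^ 2

/-- The product of `(X z - X j) ^ 2` over all `j ≥ 2`. -/
noncomputable def headProd (R : Type*) [CommRing R] {n : ℕ} (z : Fin n) :
    MvPolynomial (Fin n) R :=
  ∏ j ∈ univ.filter (fun j : Fin n => 2 ≤ (j : ℕ)), (X z - X j) ^ 2

theorem two_le_perm_iff {σ : Equiv.Perm (Fin n)} (hσ : ∀ i : Fin n, (i : ℕ) < 2 → σ i = i)
    (i : Fin n) : 2 ≤ (σ i : ℕ) ↔ 2 ≤ (i : ℕ) := by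
  rw [← not_lt, ← not_lt, not_iff_not]
  refine ⟨fun h => ?_, fun h => by rwa [hσ i h]⟩
  rwa [σ.injective (hσ _ h)] at h

theorem rename_headProd {σ : Equiv.Perm (Fin n)} (hσ : ∀ i : Fin n, (i : ℕ) < 2 → σ i = i)
    {z : Fin n} (hz : (z : ℕ) < 2) : rename σ (headProd R z) = headProd R z := by
  simp only [headProd, map_prod, map_pow, map_sub, rename_X, hσ z hz]
  exact Finset.prod_equiv σ (by simp [two_le_perm_iff hσ]) (fun _ _ => rfl)

theorem rename_tailDiscr {σ : Equiv.Perm (Fin n)}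
    (hσ : ∀ i : Fin n, (i : ℕ) < 2 → σ i = i) :
    rename σ (tailDiscr R n) = tailDiscr R n := by
  simp only [tailDiscr, map_prod, map_pow, map_sub, rename_X]
  have hσ' := two_le_perm_iff hσ
  refine Finset.prod_nbij'
    (fun p => if σ p.1 < σ p.2 then (σ p.1, σ p.2) else (σ p.2, σ p.1))
    (fun p => if σ.symm p.1 < σ.symm p.2 then (σ.symm p.1, σ.symm p.2)
      else (σ.symm p.2, σ.symm p.1)) ?_ ?_ ?_ ?_ ?_
  · rintro ⟨i, j⟩ hp
    have hne : σ i ≠ σ j := fun h => by simp [σ.injective h] at hp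
    simp only [mem_filter, mem_univ, true_and] at hp ⊢
    have := hσ' i
    have := hσ' j
    split_ifs <;> simp only <;> omega
  · rintro ⟨i, j⟩ hp
    have hne : σ.symm i ≠ σ.symm j := fun h => by simp [σ.symm.injective h] at hp
    simp only [mem_filter, mem_univ, true_and] at hp ⊢
    have h1 := hσ' (σ.symm i)
    have h2 := hσ' (σ.symm j)
    rw [Equiv.apply_symm_apply] at h1 h2
    split_ifs <;> simp only <;> omega
  · rintro ⟨i, j⟩ hp
    simp only [mem_filter, mem_univ, true_and] at hp
    by_cases h : σ i < σ j <;> simp [h, hp.2, hp.2.not_gt]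
  · rintro ⟨i, j⟩ hp
    simp only [mem_filter, mem_univ, true_and] at hp
    by_cases h : σ.symm i < σ.symm j <;> simp [h, hp.2, hp.2.not_gt]
  · rintro ⟨i, j⟩ -
    simp only
    split_ifs
    · rfl
    · simp only
      ring

theorem identify_headProd {z w : Fin n} (hw : (w : ℕ) < 2) :
    identify z w (headProd R z) = headProd R z := by
  simp only [headProd, map_prod, map_pow, map_sub, identify_X]
  refine Finset.prod_congr rfl fun j hj => ?_
  simp only [mem_filter, mem_univ, true_and] at hj
  rw [if_neg (show j ≠ w by grind), ite_self]

theorem identify_tailDiscr {z w : Fin n} (hw : (w : ℕ) < 2) :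
    identify z w (tailDiscr R n) = tailDiscr R n := by
  simp only [tailDiscr, map_prod, map_pow, map_sub, identify_X]
  refine Finset.prod_congr rfl fun p hp => ?_
  simp only [mem_filter, mem_univ, true_and] at hp
  rw [if_neg (show p.1 ≠ w by grind), if_neg (show p.2 ≠ w by grind)]

section IsDomain

variable [IsDomain R]

theorem headProd_ne_zero {z : Fin n} (hz : (z : ℕ) < 2) : headProd R z ≠ 0 := by
  refine Finset.prod_ne_zero_iff.2 fun j hj => pow_ne_zero _ (prime_X_sub_X ?_).ne_zero
  simp only [mem_filter, mem_univ, true_and] at hj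
  grind

theorem tailDiscr_ne_zero : tailDiscr R n ≠ 0 := by
  refine Finset.prod_ne_zero_iff.2 fun p hp => pow_ne_zero _ (prime_X_sub_X ?_).ne_zero
  simp only [mem_filter, mem_univ, true_and] at hp
  exact hp.2.ne

theorem headProd_mul_tailDiscr_dvd [UniqueFactorizationMonoid R] {z : Fin n} (hz : (z : ℕ) < 2)
    {g : MvPolynomial (Fin n) R}
    (h₁ : ∀ j : Fin n, 2 ≤ (j : ℕ) → (X z - X j) ^ 2 ∣ g)
    (h₂ : ∀ i j : Fin n, 2 ≤ (i : ℕ) → i < j → (X i - X j) ^ 2 ∣ g) :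
    headProd R z * tailDiscr R n ∣ g := by
  refine IsRelPrime.mul_dvd ?_ ?_ ?_
  · refine IsRelPrime.prod_left fun j hj => IsRelPrime.prod_right fun p hp =>
      (isRelPrime_X_sub_X ?_ ?_ ?_ ?_).pow
    all_goals
      simp only [mem_filter, mem_univ, true_and] at hj hp
      grind
  · refine Finset.prod_dvd_of_isRelPrime (fun i hi j hj hij =>
      (isRelPrime_X_sub_X ?_ ?_ ?_ ?_).pow) fun j hj => h₁ j (by simpa using hj)
    all_goals
      simp only [coe_filter, mem_univ, true_and, Set.mem_ofPred_eq] at hi hj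
      grind
  · refine Finset.prod_dvd_of_isRelPrime (fun p hp q hq hpq =>
      (isRelPrime_X_sub_X ?_ ?_ ?_ ?_).pow) fun p hp => ?_
    rotate_right
    · simp only [mem_filter, mem_univ, true_and] at hp
      exact h₂ _ _ hp.1 hp.2
    all_goals
      simp only [coe_filter, mem_univ, true_and, Set.mem_ofPred_eq] at hp hq
      have := mt Prod.ext_iff.2 hpq
      grind

end IsDomain

/-- A symmetric polynomial vanishing when the variables in `s` are all set equal has vanishing
partial derivatives there in the directions of `s`. -/
theorem aeval_pderiv_eq_zero [IsDomain R] [CharZero R] {f : MvPolynomial (Fin n) R}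
    (hf : f.IsSymmetric) (s : Finset (Fin n)) {z b : Fin n} (hz : z ∈ s) (hb : b ∈ s)
    (h : aeval (fun i => if i ∈ s then X z else (X i : MvPolynomial (Fin n) R)) f = 0) :
    aeval (fun i => if i ∈ s then X z else (X i : MvPolynomial (Fin n) R)) (pderiv b f) = 0 := by
  set w : Fin n → MvPolynomial (Fin n) R := fun i => if i ∈ s then X z else X i with hw
  have hsymm : ∀ i ∈ s, aeval w (pderiv i f) = aeval w (pderiv b f) := fun i hi => by
    have := hf.rename_pderiv (Equiv.swap b i) b
    rw [Equiv.swap_apply_left] at this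
    rw [← this, aeval_rename]
    congr 2
    funext k
    simp only [hw, Function.comp_apply, Equiv.swap_apply_def]
    grind
  have hd := pderiv_aeval w z f
  rw [h, map_zero] at hd
  have hterm : ∀ i, aeval w (pderiv i f) * pderiv z (w i) =
      if i ∈ s then aeval w (pderiv b f) else 0 := fun i => by
    by_cases hi : i ∈ s
    · simp only [hw, hi, if_true, pderiv_X_self, mul_one]
      exact hsymm i hi
    · have : i ≠ z := fun h => hi (h ▸ hz)
      simp only [hw, hi, if_false, pderiv_X_of_ne this, mul_zero]
  simp only [hterm, Finset.sum_ite_mem, univ_inter, sum_const, nsmul_eq_mul] at hd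
  refine (mul_eq_zero.1 hd.symm).resolve_left ?_
  exact_mod_cast (Finset.card_pos.2 ⟨b, hb⟩).ne'

end DoubleDiag

open DoubleDiag

/-- If a symmetric polynomial `f` in `n ≥ 4` variables vanishes both under `x₂ := x₁, x₄ := x₃`
and under `x₂ := x₁, x₃ := x₁`, then
`f(z,z,x₃,…,x_n) = ∏_{i=3}^n (z-x_i)² · ∏_{3≤i<j≤n} (x_i-x_j)² · h(z,x₃,…,x_n)` with `h`
symmetric in `x₃,…,x_n`.  Here `X 0` plays the role of `z`, and `X 2, …, X (n-1)` the roles of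
`x₃, …, x_n` (0-indexed). -/
theorem factorization_double_diag (n : ℕ) (hn : 4 ≤ n) (f : MvPolynomial (Fin n) ℂ)
    (hf : f.IsSymmetric)
    (h1 : MvPolynomial.aeval (R := ℂ)
        (fun i : Fin n => if (i : ℕ) = 1 then X (⟨0, by omega⟩ : Fin n)
          else if (i : ℕ) = 3 then X (⟨2, by omega⟩ : Fin n)
          else (X i : MvPolynomial (Fin n) ℂ)) f = 0)
    (h2 : MvPolynomial.aeval (R := ℂ)
        (fun i : Fin n => if (i : ℕ) ≤ 2 then X (⟨0, by omega⟩ : Fin n)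
          else (X i : MvPolynomial (Fin n) ℂ)) f = 0) :
    ∃ h : MvPolynomial (Fin n) ℂ,
      (∀ i ∈ h.vars, (i : ℕ) = 0 ∨ 2 ≤ (i : ℕ)) ∧
      (∀ σ : Equiv.Perm (Fin n), (∀ i : Fin n, (i : ℕ) < 2 → σ i = i) →
        rename (⇑σ) h = h) ∧
      MvPolynomial.aeval (R := ℂ)
        (fun i : Fin n => if (i : ℕ) ≤ 1 then X (⟨0, by omega⟩ : Fin n)
          else (X i : MvPolynomial (Fin n) ℂ)) f =
        (∏ j ∈ Finset.univ.filter (fun j : Fin n => 2 ≤ (j : ℕ)),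
            (X (⟨0, by omega⟩ : Fin n) - X j) ^ 2) *
        (∏ p ∈ Finset.univ.filter (fun p : Fin n × Fin n => 2 ≤ (p.1 : ℕ) ∧ p.1 < p.2),
            (X p.1 - X p.2) ^ 2) * h := by
  obtain ⟨z, hz⟩ : ∃ z : Fin n, z = ⟨0, by omega⟩ := ⟨_, rfl⟩
  obtain ⟨a, ha⟩ : ∃ a : Fin n, a = ⟨1, by omega⟩ := ⟨_, rfl⟩
  obtain ⟨b, hb⟩ : ∃ b : Fin n, b = ⟨2, by omega⟩ := ⟨_, rfl⟩
  obtain ⟨c, hc⟩ : ∃ c : Fin n, c = ⟨3, by omega⟩ := ⟨_, rfl⟩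
  rw [← hz] at h1 h2 ⊢
  rw [← hb] at h1
  have hz0 : (z : ℕ) = 0 := by rw [hz]
  have ha1 : (a : ℕ) = 1 := by rw [ha]
  have hb2 : (b : ℕ) = 2 := by rw [hb]
  have hc3 : (c : ℕ) = 3 := by rw [hc]
  clear hz ha hb hc
  have hdiag : aeval (R := ℂ) (fun i : Fin n => if (i : ℕ) ≤ 1 then X z
      else (X i : MvPolynomial (Fin n) ℂ)) = identify z a := by
    ext1 k
    rw [aeval_X, identify_X]
    grind
  have hpair : aeval (R := ℂ) (fun i : Fin n => if (i : ℕ) = 1 then X z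
      else if (i : ℕ) = 3 then X b else (X i : MvPolynomial (Fin n) ℂ)) =
      (identify b c).comp (identify z a) := by
    ext1 k
    rw [aeval_X, AlgHom.comp_apply, identify_X, identify_X]
    grind
  have htriple : aeval (R := ℂ) (fun i : Fin n => if (i : ℕ) ≤ 2 then X z
      else (X i : MvPolynomial (Fin n) ℂ)) = (identify z b).comp (identify z a) := by
    ext1 k
    rw [aeval_X, AlgHom.comp_apply, identify_X, identify_X]
    grind
  have hderiv : identify z b (pderiv b (identify z a f)) = 0 := by
    have hs := aeval_pderiv_eq_zero hf (univ.filter fun i : Fin n => (i : ℕ) ≤ 2)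
      (z := z) (b := b) (by simp [hz0]) (by simp [hb2])
      (by simpa only [mem_filter, mem_univ, true_and] using h2)
    simp only [mem_filter, mem_univ, true_and] at hs
    rw [htriple, AlgHom.comp_apply] at hs
    rwa [pderiv_identify (by grind) (by grind)]
  rw [hpair, AlgHom.comp_apply] at h1
  rw [htriple, AlgHom.comp_apply] at h2
  rw [hdiag]
  have hsymm : ∀ σ : Equiv.Perm (Fin n), (∀ i : Fin n, (i : ℕ) < 2 → σ i = i) →
      rename σ (identify z a f) = identify z a f := fun σ hσ => by
    rw [rename_identify, hσ z (by omega), hσ a (by omega), hf σ]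
  have hidem := identify_identify z a f
  generalize identify z a f = g at *
  have hdvd₁ : (X z - X b) ^ 2 ∣ g := sq_X_sub_X_dvd_of_pderiv (by grind) h2 hderiv
  have hdvd₂ : (X b - X c) ^ 2 ∣ g :=
    sq_X_sub_X_dvd_of_rename_swap (by grind) h1
      (hsymm _ fun i hi => Equiv.swap_apply_of_ne_of_ne (by grind) (by grind))
  obtain ⟨h, hh⟩ : headProd ℂ z * tailDiscr ℂ n ∣ g := by
    refine headProd_mul_tailDiscr_dvd (by omega) (fun j hj => ?_) fun i j hi hij => ?_
    · have hσ : ∀ k : Fin n, (k : ℕ) < 2 → Equiv.swap b j k = k := fun k hk =>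
        Equiv.swap_apply_of_ne_of_ne (by grind) (by grind)
      have := map_dvd (rename (Equiv.swap b j)) hdvd₁
      rwa [hsymm _ hσ, map_pow, map_sub, rename_X, rename_X, Equiv.swap_apply_left,
        hσ z (by omega)] at this
    · obtain ⟨σ, hσ, hσb, hσc⟩ : ∃ σ : Equiv.Perm (Fin n),
          (∀ k : Fin n, (k : ℕ) < 2 → σ k = k) ∧ σ b = i ∧ σ c = j := by
        refine ⟨(Equiv.swap c (Equiv.swap b i j)).trans (Equiv.swap b i), fun k hk => ?_, ?_, ?_⟩
        all_goals
          simp only [Equiv.trans_apply, Equiv.swap_apply_def]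
          grind
      have := map_dvd (rename σ) hdvd₂
      rwa [hsymm σ hσ, map_pow, map_sub, rename_X, rename_X, hσb, hσc] at this
  have hne : headProd ℂ z * tailDiscr ℂ n ≠ 0 :=
    mul_ne_zero (headProd_ne_zero (by omega)) tailDiscr_ne_zero
  refine ⟨h, fun i hi => ?_, fun σ hσ => ?_, hh⟩
  · have hid : identify z a h = h := by
      refine mul_left_cancel₀ hne ?_
      rw [hh, map_mul, map_mul, identify_headProd (by omega),
        identify_tailDiscr (by omega)] at hidem
      exact hidem
    rw [← hid] at hi
    obtain ⟨k, -, hk⟩ := mem_vars_bind₁ _ _ hi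
    rw [Function.update_apply] at hk
    split_ifs at hk <;> rw [vars_X, mem_singleton] at hk <;> grind
  · have := hsymm σ hσ
    rw [hh, map_mul, map_mul, rename_headProd hσ (by omega), rename_tailDiscr hσ] at this
    exact mul_left_cancel₀ hne this
end
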